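/- arXiv:1512.02364 — 2 statements merged into one kernel-verified Lean document; each statement's English description precedes it below -/
import Mathlib

section
/- Let $c \ge 0$ and $n > c$ be real numbers. Then $S_{n,c}$ is completely monotonic on $[0,+\infty)$, i.e., $(-1)^m \left(\frac{d}{dx}\right)^m S_{n,c}(x) > 0$ for all $x \ge 0$ and all integers $m \ge 0$. Consequently, $S_{n,c}$ is logarithmically convex (i.e., $\log S_{n,c}$ is convex) and hence convex on $[0,+\infty)$. -/
/-- Generalized binomial coefficient `α(α-1)⋯(α-k+1)/k!`. -/
noncomputable def genBinom (α : ℝ) (k : ℕ) : ℝ :=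
  (∏ i ∈ Finset.range k, (α - i)) / (Nat.factorial k)

/-- The basic probabilities `p_{n,k}^{[c]}(x)` for `c ≥ 0`. -/
noncomputable def pc (c n : ℝ) (k : ℕ) (x : ℝ) : ℝ :=
  if c = 0 then (n * x) ^ k / (Nat.factorial k) * Real.exp (-(n * x))
  else (-1 : ℝ) ^ k * genBinom (-n / c) k * (c * x) ^ k
    * (1 + c * x) ^ (-n / c - (k : ℝ))

/-- `S_{n,c}(x) = ∑_{k=0}^∞ (p_{n,k}^{[c]}(x))²`. -/
noncomputable def Sc (c n : ℝ) (x : ℝ) : ℝ :=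
  ∑' k : ℕ, (pc c n k x) ^ 2

open Set Filter Topology
open scoped ContDiff Real

section ParametricIntegral

variable {F : ℝ → ℝ → ℝ} {U : Set ℝ} {x : ℝ}

lemma ContDiffOn.hasDerivAt_slice (hU : IsOpen U)
    (hF : ContDiffOn ℝ ∞ (fun p : ℝ × ℝ => F p.1 p.2) (U ×ˢ univ)) (hx : x ∈ U) (t : ℝ) :
    HasDerivAt (fun y => F y t) (fderiv ℝ (fun p : ℝ × ℝ => F p.1 p.2) (x, t) (1, 0)) x := by
  have h : HasFDerivAt (fun p : ℝ × ℝ => F p.1 p.2) _ (x, t) :=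
    ((hF.contDiffAt ((hU.prod isOpen_univ).mem_nhds ⟨hx, mem_univ t⟩)).differentiableAt
      (by simp)).hasFDerivAt
  exact h.comp_hasDerivAt x ((hasDerivAt_id x).prodMk (hasDerivAt_const x t))

lemma ContDiffOn.deriv_slice (hU : IsOpen U)
    (hF : ContDiffOn ℝ ∞ (fun p : ℝ × ℝ => F p.1 p.2) (U ×ˢ univ)) :
    ContDiffOn ℝ ∞ (fun p : ℝ × ℝ => deriv (fun y => F y p.2) p.1) (U ×ˢ univ) := by
  have h : ContDiffOn ℝ ∞ (fun p => fderiv ℝ (fun p : ℝ × ℝ => F p.1 p.2) p (1, 0))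
      (U ×ˢ univ) :=
    (hF.fderiv_of_isOpen (hU.prod isOpen_univ) (by simp)).clm_apply contDiffOn_const
  exact h.congr fun p hp => (hF.hasDerivAt_slice hU hp.1 p.2).deriv

lemma ContDiffOn.iteratedDeriv_slice (hU : IsOpen U)
    (hF : ContDiffOn ℝ ∞ (fun p : ℝ × ℝ => F p.1 p.2) (U ×ˢ univ)) (m : ℕ) :
    ContDiffOn ℝ ∞ (fun p : ℝ × ℝ => iteratedDeriv m (fun y => F y p.2) p.1) (U ×ˢ univ) := by
  induction m with
  | zero => simpa using hF
  | succ m ih =>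
    simp only [iteratedDeriv_succ]
    exact ih.deriv_slice (F := fun x t => iteratedDeriv m (fun y => F y t) x) hU

lemma ContDiffOn.continuous_section
    (hF : ContDiffOn ℝ ∞ (fun p : ℝ × ℝ => F p.1 p.2) (U ×ˢ univ)) (hx : x ∈ U) :
    Continuous (F x) :=
  hF.continuousOn.comp_continuous (f := fun t : ℝ => (x, t)) (by fun_prop)
    fun t => ⟨hx, mem_univ t⟩

lemma hasDerivAt_intervalIntegral_of_contDiffOn (hU : IsOpen U)
    (hF : ContDiffOn ℝ ∞ (fun p : ℝ × ℝ => F p.1 p.2) (U ×ˢ univ)) (hx : x ∈ U) (a b : ℝ) :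
    HasDerivAt (fun y => ∫ t in a..b, F y t) (∫ t in a..b, deriv (fun y => F y t) x) x := by
  have hF' := hF.deriv_slice hU
  obtain ⟨K, hK, hKU, hKc⟩ := local_compact_nhds (hU.mem_nhds hx)
  obtain ⟨C, hC⟩ := (hKc.prod isCompact_uIcc).exists_bound_of_continuousOn
    (hF'.continuousOn.mono (prod_mono hKU (subset_univ (uIcc a b))))
  refine (intervalIntegral.hasDerivAt_integral_of_dominated_loc_of_deriv_le
    (F' := fun x t => deriv (fun y => F y t) x) (bound := fun _ => C) hK ?_
    ((hF.continuous_section hx).intervalIntegrable _ _)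
    (hF'.continuous_section (F := fun x t => deriv (fun y => F y t) x) hx).aestronglyMeasurable
    ?_ (by simp) ?_).2
  · filter_upwards [hU.mem_nhds hx] with y hy
    exact (hF.continuous_section hy).aestronglyMeasurable
  · exact .of_forall fun t ht y hy => hC (y, t) ⟨hy, uIoc_subset_uIcc ht⟩
  · exact .of_forall fun t _ y hy =>
      (hF.hasDerivAt_slice hU (hKU hy) t).differentiableAt.hasDerivAt

lemma iteratedDeriv_intervalIntegral_of_contDiffOn (hU : IsOpen U)
    (hF : ContDiffOn ℝ ∞ (fun p : ℝ × ℝ => F p.1 p.2) (U ×ˢ univ)) (a b : ℝ) (m : ℕ)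
    (hx : x ∈ U) :
    iteratedDeriv m (fun y => ∫ t in a..b, F y t) x
      = ∫ t in a..b, iteratedDeriv m (fun y => F y t) x := by
  induction m generalizing x with
  | zero => simp
  | succ m ih =>
    have h : iteratedDeriv m (fun y => ∫ t in a..b, F y t) =ᶠ[𝓝 x]
        fun x => ∫ t in a..b, iteratedDeriv m (fun y => F y t) x := by
      filter_upwards [hU.mem_nhds hx] with y hy using ih hy
    simp only [iteratedDeriv_succ]
    rw [h.deriv_eq]
    exact (hasDerivAt_intervalIntegral_of_contDiffOn
      (F := fun x t => iteratedDeriv m (fun y => F y t) x) hU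
      (hF.iteratedDeriv_slice hU m) hx a b).deriv

lemma differentiableAt_iteratedDeriv_intervalIntegral (hU : IsOpen U)
    (hF : ContDiffOn ℝ ∞ (fun p : ℝ × ℝ => F p.1 p.2) (U ×ˢ univ)) (a b : ℝ) (m : ℕ)
    (hx : x ∈ U) :
    DifferentiableAt ℝ (iteratedDeriv m (fun y => ∫ t in a..b, F y t)) x := by
  have h : iteratedDeriv m (fun y => ∫ t in a..b, F y t) =ᶠ[𝓝 x]
      fun x => ∫ t in a..b, iteratedDeriv m (fun y => F y t) x := by
    filter_upwards [hU.mem_nhds hx] with y hy using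
      iteratedDeriv_intervalIntegral_of_contDiffOn hU hF a b m hy
  rw [h.differentiableAt_iff]
  exact (hasDerivAt_intervalIntegral_of_contDiffOn
    (F := fun x t => iteratedDeriv m (fun y => F y t) x) hU
    (hF.iteratedDeriv_slice hU m) hx a b).differentiableAt

end ParametricIntegral

section LogDerivative

variable {U : Set ℝ} {f g : ℝ → ℝ}

/-- Leibniz's formula for `f' = -g f`, with alternating signs collected. -/
lemma neg_one_pow_mul_iteratedDeriv_succ_of_deriv_eq (hU : IsOpen U) (hf : ContDiffOn ℝ ∞ f U)
    (hg : ContDiffOn ℝ ∞ g U) (hfg : ∀ x ∈ U, deriv f x = -(g x * f x)) (m : ℕ) {x : ℝ}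
    (hx : x ∈ U) :
    (-1) ^ (m + 1) * iteratedDeriv (m + 1) f x = ∑ i ∈ Finset.range (m + 1),
      m.choose i * ((-1) ^ i * iteratedDeriv i g x) *
        ((-1) ^ (m - i) * iteratedDeriv (m - i) f x) := by
  have h : deriv f =ᶠ[𝓝 x] -(g * f) := by
    filter_upwards [hU.mem_nhds hx] with y hy using hfg y hy
  have hle : ((m : ℕ∞) : WithTop ℕ∞) ≤ ∞ := mod_cast le_top
  rw [iteratedDeriv_succ', h.iteratedDeriv_eq, iteratedDeriv_neg,
    iteratedDeriv_mul ((hg.contDiffAt (hU.mem_nhds hx)).of_le hle)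
      ((hf.contDiffAt (hU.mem_nhds hx)).of_le hle), mul_neg, pow_succ, mul_neg_one, neg_mul,
    neg_neg, Finset.mul_sum]
  refine Finset.sum_congr rfl fun i hi => ?_
  rw [show ((-1 : ℝ)) ^ m = (-1) ^ i * (-1) ^ (m - i) by
    rw [← pow_add, Nat.add_sub_cancel' (Finset.mem_range_succ_iff.1 hi)]]
  ring

lemma neg_one_pow_mul_iteratedDeriv_nonneg_of_deriv_eq (hU : IsOpen U)
    (hf : ContDiffOn ℝ ∞ f U) (hg : ContDiffOn ℝ ∞ g U)
    (hfg : ∀ x ∈ U, deriv f x = -(g x * f x)) (hf0 : ∀ x ∈ U, 0 < f x)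
    (hg0 : ∀ k, ∀ x ∈ U, 0 ≤ (-1) ^ k * iteratedDeriv k g x) (m : ℕ) {x : ℝ} (hx : x ∈ U) :
    0 ≤ (-1) ^ m * iteratedDeriv m f x := by
  induction m using Nat.strong_induction_on with
  | _ m ih =>
    cases m with
    | zero => simpa using (hf0 x hx).le
    | succ m =>
      rw [neg_one_pow_mul_iteratedDeriv_succ_of_deriv_eq hU hf hg hfg m hx]
      exact Finset.sum_nonneg fun i _ =>
        mul_nonneg (mul_nonneg (by positivity) (hg0 i x hx)) (ih _ (by omega))

lemma neg_one_pow_mul_iteratedDeriv_pos_of_deriv_eq (hU : IsOpen U)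
    (hf : ContDiffOn ℝ ∞ f U) (hg : ContDiffOn ℝ ∞ g U)
    (hfg : ∀ x ∈ U, deriv f x = -(g x * f x)) (hf0 : ∀ x ∈ U, 0 < f x)
    (hg0 : ∀ k, ∀ x ∈ U, 0 ≤ (-1) ^ k * iteratedDeriv k g x) (m : ℕ) {x : ℝ} (hx : x ∈ U)
    (hgx : 0 < g x) :
    0 < (-1) ^ m * iteratedDeriv m f x := by
  induction m with
  | zero => simpa using hf0 x hx
  | succ m ih =>
    rw [neg_one_pow_mul_iteratedDeriv_succ_of_deriv_eq hU hf hg hfg m hx]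
    refine Finset.sum_pos' (fun i _ => mul_nonneg (mul_nonneg (by positivity) (hg0 i x hx))
      (neg_one_pow_mul_iteratedDeriv_nonneg_of_deriv_eq hU hf hg hfg hf0 hg0 _ hx))
      ⟨0, by simp, ?_⟩
    simpa using mul_pos hgx ih

lemma deriv_sq_le_mul_iteratedDeriv_two_of_deriv_eq (hU : IsOpen U)
    (hf : ContDiffOn ℝ ∞ f U) (hg : ContDiffOn ℝ ∞ g U)
    (hfg : ∀ x ∈ U, deriv f x = -(g x * f x)) {x : ℝ} (hx : x ∈ U)
    (hg1 : deriv g x ≤ 0) : deriv f x ^ 2 ≤ f x * iteratedDeriv 2 f x := by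
  have h := neg_one_pow_mul_iteratedDeriv_succ_of_deriv_eq hU hf hg hfg 1 hx
  simp only [Finset.sum_range_succ, Finset.sum_range_zero, iteratedDeriv_zero,
    iteratedDeriv_one] at h
  norm_num at h
  rw [h, hfg x hx]
  nlinarith [mul_nonneg (neg_nonneg.2 hg1) (sq_nonneg (f x))]

end LogDerivative

section Mixture

variable {F G : ℝ → ℝ → ℝ} {S : ℝ → ℝ} {U : Set ℝ} {a b x : ℝ}

lemma neg_one_pow_mul_iteratedDeriv_intervalIntegral_pos (hab : a < b) (hU : IsOpen U)
    (hF : ContDiffOn ℝ ∞ (fun p : ℝ × ℝ => F p.1 p.2) (U ×ˢ univ))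
    (hG : ∀ t, ContDiffOn ℝ ∞ (fun y => G y t) U)
    (hFG : ∀ t, ∀ x ∈ U, HasDerivAt (fun y => F y t) (-(G x t * F x t)) x)
    (hF0 : ∀ t, ∀ x ∈ U, 0 < F x t)
    (hG0 : ∀ t k, ∀ x ∈ U, 0 ≤ (-1) ^ k * iteratedDeriv k (fun y => G y t) x)
    (hGpos : ∃ t ∈ Icc a b, ∀ x ∈ U, 0 < G x t) (m : ℕ) (hx : x ∈ U) :
    0 < (-1) ^ m * iteratedDeriv m (fun y => ∫ t in a..b, F y t) x := by
  have hslice (t : ℝ) : ContDiffOn ℝ ∞ (fun y => F y t) U :=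
    hF.comp (t := U ×ˢ univ) (f := fun y : ℝ => (y, t)) (by fun_prop)
      fun y hy => ⟨hy, mem_univ t⟩
  rw [iteratedDeriv_intervalIntegral_of_contDiffOn hU hF a b m hx,
    ← intervalIntegral.integral_const_mul]
  have hc : Continuous fun t => (-1) ^ m * iteratedDeriv m (fun y => F y t) x :=
    continuous_const.mul ((hF.iteratedDeriv_slice hU m).continuous_section
      (F := fun x t => iteratedDeriv m (fun y => F y t) x) hx)
  obtain ⟨t, ht, hpos⟩ := hGpos
  exact intervalIntegral.integral_pos hab hc.continuousOn
    (fun t _ => neg_one_pow_mul_iteratedDeriv_nonneg_of_deriv_eq hU (hslice t) (hG t)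
      (fun y hy => (hFG t y hy).deriv) (hF0 t) (hG0 t) m hx)
    ⟨t, ht, neg_one_pow_mul_iteratedDeriv_pos_of_deriv_eq hU (hslice t) (hG t)
      (fun y hy => (hFG t y hy).deriv) (hF0 t) (hG0 t) m hx (hpos x hx)⟩

lemma deriv_sq_le_mul_iteratedDeriv_two_intervalIntegral (hab : a ≤ b) (hU : IsOpen U)
    (hF : ContDiffOn ℝ ∞ (fun p : ℝ × ℝ => F p.1 p.2) (U ×ˢ univ))
    (hF0 : ∀ t, 0 < F x t)
    (hF2 : ∀ t, deriv (fun y => F y t) x ^ 2 ≤ F x t * iteratedDeriv 2 (fun y => F y t) x)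
    (hx : x ∈ U) :
    deriv (fun y => ∫ t in a..b, F y t) x ^ 2
      ≤ (∫ t in a..b, F x t) * iteratedDeriv 2 (fun y => ∫ t in a..b, F y t) x := by
  have hint (m : ℕ) : IntervalIntegrable (fun t => iteratedDeriv m (fun y => F y t) x)
      MeasureTheory.volume a b :=
    ((hF.iteratedDeriv_slice hU m).continuous_section
      (F := fun x t => iteratedDeriv m (fun y => F y t) x) hx).intervalIntegrable _ _
  have h0 := hint 0
  have h1 := hint 1
  have h2 := hint 2
  simp only [iteratedDeriv_zero, iteratedDeriv_one] at h0 h1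
  have e1 := iteratedDeriv_intervalIntegral_of_contDiffOn hU hF a b 1 hx
  simp only [iteratedDeriv_one] at e1
  rw [iteratedDeriv_intervalIntegral_of_contDiffOn hU hF a b 2 hx, e1]
  have key (s : ℝ) : 0 ≤ (∫ t in a..b, iteratedDeriv 2 (fun y => F y t) x) * (s * s)
      + (2 * ∫ t in a..b, deriv (fun y => F y t) x) * s + ∫ t in a..b, F x t := by
    have : 0 ≤ ∫ t in a..b, (s ^ 2 * iteratedDeriv 2 (fun y => F y t) x
        + 2 * s * deriv (fun y => F y t) x + F x t) := by
      refine intervalIntegral.integral_nonneg hab fun t _ => ?_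
      have hpos := hF0 t
      refine nonneg_of_mul_nonneg_right ?_ hpos
      nlinarith [mul_le_mul_of_nonneg_left (hF2 t) (sq_nonneg s),
        sq_nonneg (s * deriv (fun y => F y t) x + F x t)]
    rw [intervalIntegral.integral_add ((h2.const_mul _).add (h1.const_mul _)) h0,
      intervalIntegral.integral_add (h2.const_mul _) (h1.const_mul _),
      intervalIntegral.integral_const_mul, intervalIntegral.integral_const_mul] at this
    linarith
  have := discrim_le_zero key
  rw [discrim] at this
  linarith

lemma convexOn_log_of_deriv_sq_le (hU : IsOpen U) {D : Set ℝ} (hD : Convex ℝ D) (hDU : D ⊆ U)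
    (hS0 : ∀ x ∈ U, 0 < S x) (hS : ∀ x ∈ U, DifferentiableAt ℝ S x)
    (hS' : ∀ x ∈ U, DifferentiableAt ℝ (deriv S) x)
    (h : ∀ x ∈ U, deriv S x ^ 2 ≤ S x * iteratedDeriv 2 S x) :
    ConvexOn ℝ D fun x => Real.log (S x) := by
  have hd {x : ℝ} (hx : x ∈ U) : deriv (fun x => Real.log (S x)) x = deriv S x / S x :=
    ((hS x hx).hasDerivAt.log (hS0 x hx).ne').deriv
  have hd' {x : ℝ} (hx : x ∈ U) :
      deriv (fun x => Real.log (S x)) =ᶠ[𝓝 x] fun x => deriv S x / S x := by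
    filter_upwards [hU.mem_nhds hx] with y hy using hd hy
  have hq {x : ℝ} (hx : x ∈ U) := (hS' x hx).hasDerivAt.fun_div (hS x hx).hasDerivAt (hS0 x hx).ne'
  refine convexOn_of_deriv2_nonneg' hD
    (fun x hx => ((hS x (hDU hx)).log (hS0 x (hDU hx)).ne').differentiableWithinAt)
    (fun x hx => (((hd' (hDU hx)).differentiableAt_iff).2
      (hq (hDU hx)).differentiableAt).differentiableWithinAt) fun x hx => ?_
  simp only [Function.iterate_succ, Function.iterate_zero, Function.comp_apply, id]
  rw [(hd' (hDU hx)).deriv_eq, (hq (hDU hx)).deriv]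
  have := h x (hDU hx)
  rw [iteratedDeriv_succ, iteratedDeriv_one] at this
  exact div_nonneg (by nlinarith) (sq_nonneg _)

/-- A mixture `∫ F x t dt` of functions with `∂F/∂x = -G F`, where each `G(·, t)` has
derivatives of alternating signs, is completely monotonic and logarithmically convex. -/
theorem completelyMonotone_and_convexOn_of_eqOn_intervalIntegral (hab : a < b) (hU : IsOpen U)
    {D : Set ℝ} (hD : Convex ℝ D) (hDU : D ⊆ U)
    (hF : ContDiffOn ℝ ∞ (fun p : ℝ × ℝ => F p.1 p.2) (U ×ˢ univ))
    (hG : ∀ t, ContDiffOn ℝ ∞ (fun y => G y t) U)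
    (hFG : ∀ t, ∀ x ∈ U, HasDerivAt (fun y => F y t) (-(G x t * F x t)) x)
    (hF0 : ∀ t, ∀ x ∈ U, 0 < F x t)
    (hG0 : ∀ t k, ∀ x ∈ U, 0 ≤ (-1) ^ k * iteratedDeriv k (fun y => G y t) x)
    (hGpos : ∃ t ∈ Icc a b, ∀ x ∈ U, 0 < G x t)
    (hS : EqOn S (fun x => ∫ t in a..b, F x t) U) :
    (∀ m : ℕ, ∀ x ∈ D, 0 < (-1 : ℝ) ^ m * iteratedDeriv m S x) ∧
      ConvexOn ℝ D (fun x => Real.log (S x)) ∧ ConvexOn ℝ D S := by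
  have hev {x : ℝ} (hx : x ∈ U) : S =ᶠ[𝓝 x] fun x => ∫ t in a..b, F x t :=
    hS.eventuallyEq_of_mem (hU.mem_nhds hx)
  have hpos (m : ℕ) (x : ℝ) (hx : x ∈ U) : 0 < (-1 : ℝ) ^ m * iteratedDeriv m S x := by
    rw [(hev hx).iteratedDeriv_eq]
    exact neg_one_pow_mul_iteratedDeriv_intervalIntegral_pos hab hU hF hG hFG hF0 hG0 hGpos m hx
  have hdiff (m : ℕ) (x : ℝ) (hx : x ∈ U) : DifferentiableAt ℝ (iteratedDeriv m S) x := by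
    rw [((hev hx).iteratedDeriv m).differentiableAt_iff]
    exact differentiableAt_iteratedDeriv_intervalIntegral hU hF a b m hx
  have hS0 : ∀ x ∈ U, 0 < S x := fun x hx => by simpa using hpos 0 x hx
  have hS1 : ∀ x ∈ U, DifferentiableAt ℝ S x := fun x hx => by simpa using hdiff 0 x hx
  have hS2 : ∀ x ∈ U, DifferentiableAt ℝ (deriv S) x := fun x hx => by
    simpa using hdiff 1 x hx
  refine ⟨fun m x hx => hpos m x (hDU hx),
    convexOn_log_of_deriv_sq_le hU hD hDU hS0 hS1 hS2 fun x hx => ?_,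
    convexOn_of_deriv2_nonneg' hD (fun x hx => (hS1 x (hDU hx)).differentiableWithinAt)
      (fun x hx => (hS2 x (hDU hx)).differentiableWithinAt) fun x hx => ?_⟩
  · rw [(hev hx).deriv_eq, (hev hx).iteratedDeriv_eq, hS hx]
    refine deriv_sq_le_mul_iteratedDeriv_two_intervalIntegral hab.le hU hF
      (fun t => hF0 t x hx) (fun t => ?_) hx
    refine deriv_sq_le_mul_iteratedDeriv_two_of_deriv_eq hU
      (hF.comp (t := U ×ˢ univ) (f := fun y : ℝ => (y, t)) (by fun_prop)
        fun y hy => ⟨hy, mem_univ t⟩) (hG t) (fun y hy => (hFG t y hy).deriv) hx ?_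
    simpa using hG0 t 1 x hx
  · rw [← iteratedDeriv_eq_iterate]
    simpa using (hpos 2 x (hDU hx)).le

end Mixture

section Parseval

open Complex in
lemma integral_exp_two_mul_int_mul_I (m : ℤ) :
    ∫ t in (-(π / 2))..(π / 2), cexp (2 * m * I * t) = if m = 0 then (π : ℂ) else 0 := by
  split_ifs with hm
  · simp [hm]
  · have hm' : (m : ℂ) ≠ 0 := mod_cast hm
    rw [integral_exp_mul_complex (by simp [hm'])]
    have h : cexp (2 * m * I * ((π / 2 : ℝ) : ℂ)) = cexp (2 * m * I * ((-(π / 2) : ℝ) : ℂ)) :=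
      Complex.exp_eq_exp_iff_exists_int.2 ⟨m, by push_cast; ring⟩
    rw [h, sub_self, zero_div]

open Complex in
/-- Parseval's identity for an absolutely convergent power series on the unit circle. -/
lemma tsum_sq_eq_integral_norm_sq {h : ℕ → ℝ} (hs : Summable fun k => |h k|) {f : ℝ → ℂ}
    (hf : ∀ t : ℝ, HasSum (fun k : ℕ => (h k : ℂ) * cexp (2 * k * I * t)) (f t)) :
    ∑' k, h k ^ 2 = π⁻¹ * ∫ t in (-(π / 2))..(π / 2), ‖f t‖ ^ 2 := by
  have hnorm (k : ℕ) (t : ℝ) : ‖(h k : ℂ) * cexp (2 * k * I * t)‖ = |h k| := by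
    rw [norm_mul, show (2 * k * I * t : ℂ) = ((2 * k * t : ℝ) : ℂ) * I by push_cast; ring,
      norm_exp_ofReal_mul_I, mul_one, norm_real, Real.norm_eq_abs]
  have hprod (t : ℝ) : HasSum (fun p : ℕ × ℕ =>
      ((h p.1 * h p.2 : ℝ) : ℂ) * cexp (2 * ((p.1 - p.2 : ℤ) : ℂ) * I * t))
      ((‖f t‖ ^ 2 : ℝ) : ℂ) := by
    have h1 : Summable fun k : ℕ => ‖(h k : ℂ) * cexp (2 * k * I * t)‖ := by
      simpa only [hnorm] using hs
    have h2 : Summable fun k : ℕ => ‖(starRingEnd ℂ) ((h k : ℂ) * cexp (2 * k * I * t))‖ := by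
      simpa only [RCLike.norm_conj] using h1
    have h3 := (summable_mul_of_summable_norm h1 h2).hasSum
    have h4 : HasSum (fun k : ℕ => (starRingEnd ℂ) ((h k : ℂ) * cexp (2 * k * I * t)))
        ((starRingEnd ℂ) (f t)) := (hf t).map (starRingEnd ℂ) continuous_conj
    rw [← tsum_mul_tsum_of_summable_norm h1 h2, (hf t).tsum_eq, h4.tsum_eq, mul_conj,
      normSq_eq_norm_sq] at h3
    refine h3.congr_fun fun p => ?_
    rw [map_mul, conj_ofReal, ← exp_conj, mul_mul_mul_comm, ← exp_add]
    congr 1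
    · push_cast; rfl
    · congr 1
      simp [show (starRingEnd ℂ) 2 = 2 from map_ofNat _ 2]
      ring
  have hint := intervalIntegral.hasSum_integral_of_dominated_convergence
    (μ := MeasureTheory.volume) (a := -(π / 2)) (b := π / 2)
    (fun (p : ℕ × ℕ) (_ : ℝ) => |h p.1| * |h p.2|)
    (fun p => (by fun_prop : Continuous fun t : ℝ => ((h p.1 * h p.2 : ℝ) : ℂ) *
      cexp (2 * ((p.1 - p.2 : ℤ) : ℂ) * I * t)).aestronglyMeasurable)
    (fun p => .of_forall fun t _ => by
      rw [norm_mul, show (2 * ((p.1 - p.2 : ℤ) : ℂ) * I * t : ℂ)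
        = ((2 * (p.1 - p.2 : ℤ) * t : ℝ) : ℂ) * I by push_cast; ring,
        norm_exp_ofReal_mul_I, mul_one, norm_real, Real.norm_eq_abs, abs_mul])
    (.of_forall fun t _ => hs.mul_of_nonneg hs (fun _ => abs_nonneg _) (fun _ => abs_nonneg _))
    (by simp) (.of_forall fun t _ => hprod t)
  simp only [intervalIntegral.integral_const_mul, integral_exp_two_mul_int_mul_I] at hint
  have hinj : Function.Injective fun k : ℕ => (k, k) := fun _ _ h => (Prod.ext_iff.1 h).1
  rw [← hinj.hasSum_iff] at hint
  · have hint' : HasSum (fun k => h k ^ 2 * π) (∫ t in (-(π / 2))..(π / 2), ‖f t‖ ^ 2) := by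
      rw [intervalIntegral.integral_ofReal] at hint
      rw [← Complex.hasSum_ofReal]
      refine hint.congr_fun fun k => ?_
      simp [sq]
    rw [← hint'.tsum_eq, tsum_mul_right]
    field_simp
  · rintro ⟨j, k⟩ hjk
    have : (j : ℤ) - k ≠ 0 := fun h => hjk ⟨j, by simp; omega⟩
    simp [this]

end Parseval

section Substitution

lemma intervalIntegral_eq_integral_arctan (g : ℝ → ℝ) :
    ∫ t in (-(π / 2))..(π / 2), g t = ∫ s, (1 + s ^ 2)⁻¹ * g (Real.arctan s) := by
  rw [intervalIntegral.integral_of_le (by linarith [Real.pi_pos]),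
    MeasureTheory.integral_Ioc_eq_integral_Ioo, ← Real.range_arctan, ← image_univ,
    MeasureTheory.integral_image_eq_integral_abs_deriv_smul MeasurableSet.univ
      (fun x _ => (Real.hasDerivAt_arctan x).hasDerivWithinAt) Real.arctan_injective.injOn]
  simp only [MeasureTheory.Measure.restrict_univ, smul_eq_mul, one_div]
  congr with s
  rw [abs_of_pos (by positivity)]

lemma integral_cos_sq_add_mul_sin_sq_rpow {u : ℝ} (hu : 0 < u) (a : ℝ) :
    ∫ t in (-(π / 2))..(π / 2), (Real.cos t ^ 2 + u ^ 2 * Real.sin t ^ 2) ^ (-a)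
      = ∫ t in (-(π / 2))..(π / 2),
        u⁻¹ * (Real.cos t ^ 2 + Real.sin t ^ 2 / u ^ 2) ^ (a - 1) := by
  rw [intervalIntegral.integral_const_mul, intervalIntegral_eq_integral_arctan,
    intervalIntegral_eq_integral_arctan]
  have h := MeasureTheory.Measure.integral_comp_mul_left (fun s => (1 + s ^ 2)⁻¹ *
    (Real.cos (Real.arctan s) ^ 2 + Real.sin (Real.arctan s) ^ 2 / u ^ 2) ^ (a - 1)) u
  rw [abs_of_pos (inv_pos.2 hu), smul_eq_mul] at h
  rw [← h]
  congr with s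
  simp only [Real.cos_sq_arctan, Real.sin_sq_arctan]
  have h1 : 0 < 1 + s ^ 2 := by positivity
  have h2 : 0 < 1 + (u * s) ^ 2 := by positivity
  have e1 : 1 / (1 + s ^ 2) + u ^ 2 * (s ^ 2 / (1 + s ^ 2))
      = ((1 + s ^ 2) / (1 + (u * s) ^ 2))⁻¹ := by
    field_simp
  have e2 : 1 / (1 + (u * s) ^ 2) + (u * s) ^ 2 / (1 + (u * s) ^ 2) / u ^ 2
      = (1 + s ^ 2) / (1 + (u * s) ^ 2) := by
    field_simp
  rw [e1, e2, Real.inv_rpow (by positivity), Real.rpow_neg (by positivity), inv_inv,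
    Real.rpow_sub_one (by positivity)]
  field_simp

end Substitution

section Representation

variable {c n x : ℝ}

lemma genBinom_eq_choose (α : ℝ) (k : ℕ) : genBinom α k = Ring.choose α k := by
  rw [genBinom, Ring.choose_eq_smul, ← Polynomial.aeval_eq_smeval, smul_eq_mul,
    ← descPochhammer_eval_eq_prod_range, Polynomial.aeval_def, ← Polynomial.eval_map,
    show (algebraMap ℤ ℝ) = Int.castRingHom ℝ from rfl, descPochhammer_map, div_eq_inv_mul]

lemma pc_of_pos (hc : 0 < c) (hx : 0 < 1 + c * x) (k : ℕ) :
    pc c n k x = (1 + c * x) ^ (-n / c) *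
      (Ring.choose (-n / c) k * (-(c * x / (1 + c * x))) ^ k) := by
  rw [pc, if_neg hc.ne', genBinom_eq_choose, Real.rpow_sub hx, Real.rpow_natCast,
    neg_pow (c * x / (1 + c * x)), div_pow]
  ring

open Complex in
lemma hasSum_choose_mul_pow (α : ℝ) {w : ℂ} (hw : ‖w‖ < 1) :
    HasSum (fun k => (Ring.choose α k : ℂ) * w ^ k) ((1 + w) ^ (α : ℂ)) := by
  have h := (one_add_cpow_hasFPowerSeriesOnBall_zero (a := (α : ℂ))).hasSum (y := w)
    (by simpa [← ofReal_norm] using hw)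
  simpa only [binomialSeries_apply, List.ofFn_const, List.prod_replicate, smul_eq_mul,
    ofReal_choose, zero_add] using h

lemma summable_abs_choose_mul_pow (α : ℝ) {z : ℝ} (hz : |z| < 1) :
    Summable fun k => |Ring.choose α k * z ^ k| := by
  have h := (binomialSeries ℝ α).summable_norm_apply (x := z)
    (Metric.eball_subset_eball binomialSeries_radius_ge_one
      (by simpa [← ofReal_norm] using hz))
  simpa only [binomialSeries_apply, List.ofFn_const, List.prod_replicate, smul_eq_mul,
    Real.norm_eq_abs] using h

open Complex in
lemma norm_one_sub_mul_exp_sq (z t : ℝ) :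
    ‖1 + ((-z : ℝ) : ℂ) * cexp (2 * I * t)‖ ^ 2
      = (1 - z) ^ 2 + 4 * z * Real.sin t ^ 2 := by
  rw [show (2 * I * t : ℂ) = ((2 * t : ℝ) : ℂ) * I by push_cast; ring, exp_mul_I,
    ← ofReal_cos, ← ofReal_sin, ← normSq_eq_norm_sq, normSq_apply]
  simp only [add_re, one_re, mul_re, ofReal_re, ofReal_im, I_re, I_im, add_im, one_im, mul_im,
    Real.cos_two_mul, Real.sin_two_mul, Real.cos_sq']
  linear_combination (4 * z ^ 2 * Real.sin t ^ 2) * Real.sin_sq_add_cos_sq t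

open Complex in
lemma Sc_eq_integral_of_pos (hc : 0 < c) (hx : 0 < 1 + 2 * c * x) :
    Sc c n x = ∫ t in (-(π / 2))..(π / 2), π⁻¹ * ((1 + 2 * c * x)⁻¹ *
      (Real.cos t ^ 2 + Real.sin t ^ 2 / (1 + 2 * c * x) ^ 2) ^ (n / c - 1)) := by
  have hy : 0 < 1 + c * x := by linarith
  set z := c * x / (1 + c * x) with hz_def
  have hz : |z| < 1 := by
    rw [hz_def, abs_div, abs_of_pos hy, div_lt_one hy, abs_lt]
    constructor <;> linarith
  have hs : Summable fun k => |pc c n k x| := by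
    simp only [pc_of_pos hc hy, abs_mul ((1 + c * x) ^ (-n / c))]
    exact (summable_abs_choose_mul_pow _ (by rwa [abs_neg])).mul_left _
  have hw (t : ℝ) : ‖((-z : ℝ) : ℂ) * cexp (2 * I * t)‖ < 1 := by
    rw [show (2 * I * t : ℂ) = ((2 * t : ℝ) : ℂ) * I by push_cast; ring, norm_mul,
      norm_exp_ofReal_mul_I, mul_one, norm_real, Real.norm_eq_abs, abs_neg]
    exact hz
  rw [Sc, tsum_sq_eq_integral_norm_sq hs (f := fun t => (((1 + c * x) ^ (-n / c) : ℝ) : ℂ) *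
    (1 + ((-z : ℝ) : ℂ) * cexp (2 * I * t)) ^ ((-n / c : ℝ) : ℂ)),
    intervalIntegral.integral_const_mul, ← integral_cos_sq_add_mul_sin_sq_rpow hx]
  · congr 2 with t
    rw [norm_mul, norm_cpow_real, norm_real, Real.norm_of_nonneg (by positivity), mul_pow,
      ← Real.rpow_natCast, ← Real.rpow_natCast, ← Real.rpow_mul hy.le,
      ← Real.rpow_mul (norm_nonneg _), mul_comm (-n / c), Real.rpow_mul hy.le,
      Real.rpow_mul (norm_nonneg _), Real.rpow_natCast, Real.rpow_natCast,
      norm_one_sub_mul_exp_sq, neg_div, ← Real.mul_rpow (by positivity)]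
    · congr 1
      rw [Real.cos_sq', hz_def]
      field_simp
      ring
    · rw [← norm_one_sub_mul_exp_sq]
      positivity
  · intro t
    refine ((hasSum_choose_mul_pow (-n / c) (hw t)).mul_left _).congr_fun fun k => ?_
    rw [pc_of_pos hc hy, ← hz_def, mul_pow, ← Complex.exp_nat_mul,
      show (k * (2 * I * t) : ℂ) = 2 * k * I * t by ring]
    push_cast
    ring

open Complex in
lemma Sc_zero_eq_integral :
    Sc 0 n x = ∫ t in (-(π / 2))..(π / 2), π⁻¹ * Real.exp (-(4 * n * Real.sin t ^ 2) * x) := by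
  have hpc (k : ℕ) : pc 0 n k x = Real.exp (-(n * x)) * ((n * x) ^ k / k.factorial) := by
    rw [pc, if_pos rfl, mul_comm]
  have hs : Summable fun k => |pc 0 n k x| := by
    simp only [hpc]
    exact ((Real.summable_pow_div_factorial (n * x)).mul_left _).abs
  rw [Sc, tsum_sq_eq_integral_norm_sq hs (f := fun t => ((Real.exp (-(n * x)) : ℝ) : ℂ) *
    cexp ((n * x : ℝ) * cexp (2 * I * t))), intervalIntegral.integral_const_mul]
  · congr 2 with t
    rw [norm_mul, norm_real, Real.norm_of_nonneg (Real.exp_pos _).le, norm_exp,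
      show (2 * I * t : ℂ) = ((2 * t : ℝ) : ℂ) * I by push_cast; ring, re_ofReal_mul,
      exp_ofReal_mul_I_re, ← Real.exp_add, ← Real.exp_nat_mul, Real.cos_two_mul, Real.cos_sq']
    congr 1
    push_cast
    ring
  · intro t
    have h : HasSum (fun k : ℕ => ((n * x : ℝ) * cexp (2 * I * t)) ^ k / (k.factorial : ℂ))
        (cexp ((n * x : ℝ) * cexp (2 * I * t))) := by
      rw [Complex.exp_eq_exp_ℂ]
      exact NormedSpace.expSeries_div_hasSum_exp _
    refine (h.mul_left _).congr_fun fun k => ?_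
    rw [hpc, mul_pow ((n * x : ℝ) : ℂ), ← Complex.exp_nat_mul,
      show (k * (2 * I * t) : ℂ) = 2 * k * I * t by ring]
    push_cast
    ring

end Representation

section LogDerivativeOfKernel

variable {b c x t : ℝ}

lemma iteratedDeriv_eq_of_hasDerivAt {U : Set ℝ} (hU : IsOpen U) {H : ℕ → ℝ → ℝ}
    (hH : ∀ k, ∀ x ∈ U, HasDerivAt (H k) (H (k + 1) x) x) (k : ℕ) (hx : x ∈ U) :
    iteratedDeriv k (H 0) x = H k x := by
  induction k generalizing x with
  | zero => simp
  | succ k ih =>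
    have h : iteratedDeriv k (H 0) =ᶠ[𝓝 x] H k := by
      filter_upwards [hU.mem_nhds hx] with y hy using ih hy
    rw [iteratedDeriv_succ, h.deriv_eq, (hH k x hx).deriv]

lemma hasDerivAt_re_div_pow (C S : ℝ) (hD : (C : ℂ) * (1 + 2 * c * x) + S * Complex.I ≠ 0)
    (k : ℕ) :
    HasDerivAt (fun x : ℝ => (((C : ℂ) / (C * (1 + 2 * c * x) + S * Complex.I)) ^ (k + 1)).re)
      (-(2 * c) * (k + 1) *
        (((C : ℂ) / (C * (1 + 2 * c * x) + S * Complex.I)) ^ (k + 2)).re) x := by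
  have h1 : HasDerivAt (fun z : ℂ => (C : ℂ) * (1 + 2 * c * z) + S * Complex.I)
      (C * (2 * c)) (x : ℂ) := by
    simpa using ((((hasDerivAt_id (x : ℂ)).const_mul (2 * c : ℂ)).const_add 1).const_mul
      (C : ℂ)).add_const (S * Complex.I)
  have h2 := (((hasDerivAt_const (x : ℂ) (C : ℂ)).fun_div h1 hD).fun_pow (k + 1)).real_of_complex
  convert h2 using 1
  rw [show (-(2 * c) * (k + 1) : ℝ) *
      (((C : ℂ) / (C * (1 + 2 * c * x) + S * Complex.I)) ^ (k + 2)).re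
    = (((-(2 * c) * (k + 1) : ℝ) : ℂ) *
      ((C : ℂ) / (C * (1 + 2 * c * x) + S * Complex.I)) ^ (k + 2)).re by
    rw [Complex.re_ofReal_mul]]
  congr 1
  push_cast
  simp only [div_pow]
  field_simp
  ring

/-- Minus the logarithmic derivative of `u⁻¹ (cos² t + sin² t / u²) ^ b`, `u = 1 + 2 c x`. -/
noncomputable def kernelNegLogDeriv (b c t x : ℝ) : ℝ :=
  2 * c * ((1 + 2 * b) / (1 + 2 * c * x) - 2 * b * (Real.cos t ^ 2 * (1 + 2 * c * x) /
    (Real.cos t ^ 2 * (1 + 2 * c * x) ^ 2 + Real.sin t ^ 2)))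

lemma cos_sq_mul_add_sin_sq_pos {u : ℝ} (hu : 0 < u) (t : ℝ) :
    0 < Real.cos t ^ 2 * u ^ 2 + Real.sin t ^ 2 := by
  rcases eq_or_ne (Real.sin t) 0 with h | h
  · have : Real.cos t ^ 2 = 1 := by rw [Real.cos_sq', h]; norm_num
    rw [this]; positivity
  · positivity

lemma cos_sq_add_sin_sq_div_pos {u : ℝ} (hu : 0 < u) (t : ℝ) :
    0 < Real.cos t ^ 2 + Real.sin t ^ 2 / u ^ 2 := by
  rw [show Real.cos t ^ 2 + Real.sin t ^ 2 / u ^ 2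
    = (Real.cos t ^ 2 * u ^ 2 + Real.sin t ^ 2) / u ^ 2 by field_simp]
  exact div_pos (cos_sq_mul_add_sin_sq_pos hu t) (by positivity)

lemma contDiffOn_kernelNegLogDeriv :
    ContDiffOn ℝ ∞ (kernelNegLogDeriv b c t) {x | 0 < 1 + 2 * c * x} := by
  unfold kernelNegLogDeriv
  refine contDiffOn_const.mul (.sub (.div (by fun_prop) (by fun_prop) fun x hx => ne_of_gt hx)
    (contDiffOn_const.mul (.div (by fun_prop) (by fun_prop) fun x hx => ?_)))
  exact (cos_sq_mul_add_sin_sq_pos hx t).ne'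

lemma re_mul_add_mul_I (C S c x : ℝ) :
    ((C : ℂ) * (1 + 2 * c * x) + S * Complex.I).re = C * (1 + 2 * c * x) := by
  simp

lemma normSq_mul_add_mul_I (C S c x : ℝ) :
    Complex.normSq ((C : ℂ) * (1 + 2 * c * x) + S * Complex.I)
      = C ^ 2 * (1 + 2 * c * x) ^ 2 + S ^ 2 := by
  rw [show (C * (1 + 2 * c * x) + S * Complex.I : ℂ)
    = ((C * (1 + 2 * c * x) : ℝ) : ℂ) + (S : ℂ) * Complex.I by push_cast; rfl,
    Complex.normSq_add_mul_I]
  ring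

lemma iteratedDeriv_kernelNegLogDeriv (k : ℕ) (hx : 0 < 1 + 2 * c * x) :
    iteratedDeriv k (kernelNegLogDeriv b c t) x = 2 * c * ((-(2 * c)) ^ k * k.factorial *
      ((1 + 2 * b) * (1 / (1 + 2 * c * x)) ^ (k + 1) - 2 * b * (((Real.cos t : ℂ) /
        (Real.cos t * (1 + 2 * c * x) + Real.sin t * Complex.I)) ^ (k + 1)).re)) := by
  have hU : IsOpen {x : ℝ | 0 < 1 + 2 * c * x} := isOpen_lt (by fun_prop) (by fun_prop)
  rw [show kernelNegLogDeriv b c t = fun x : ℝ => 2 * c * ((-(2 * c)) ^ 0 *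
      (Nat.factorial 0 : ℝ) * ((1 + 2 * b) * (1 / (1 + 2 * c * x)) ^ (0 + 1) -
        2 * b * (((Real.cos t : ℂ) /
        (Real.cos t * (1 + 2 * c * x) + Real.sin t * Complex.I)) ^ (0 + 1)).re)) from ?_]
  · refine iteratedDeriv_eq_of_hasDerivAt (H := fun k x => 2 * c * ((-(2 * c)) ^ k *
      (k.factorial : ℝ) * ((1 + 2 * b) * (1 / (1 + 2 * c * x)) ^ (k + 1) -
        2 * b * (((Real.cos t : ℂ) /
        (Real.cos t * (1 + 2 * c * x) + Real.sin t * Complex.I)) ^ (k + 1)).re)))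
      hU (fun k y hy => ?_) k hx
    have hy' : 0 < 1 + 2 * c * y := hy
    have h1 : HasDerivAt (fun x : ℝ => (1 / (1 + 2 * c * x)) ^ (k + 1))
        (-(2 * c) * (k + 1) * (1 / (1 + 2 * c * y)) ^ (k + 2)) y := by
      have hl : HasDerivAt (fun x : ℝ => 1 + 2 * c * x) (2 * c) y := by
        simpa using ((hasDerivAt_id y).const_mul (2 * c)).const_add 1
      refine (((hasDerivAt_const y (1 : ℝ)).fun_div hl hy'.ne').fun_pow (k + 1)).congr_deriv ?_
      push_cast
      simp only [div_pow]
      field_simp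
      ring
    have hD : (Real.cos t : ℂ) * (1 + 2 * c * y) + Real.sin t * Complex.I ≠ 0 := by
      rw [← Complex.normSq_pos, normSq_mul_add_mul_I]
      exact cos_sq_mul_add_sin_sq_pos hy' t
    have h2 := hasDerivAt_re_div_pow _ _ hD k
    refine ((((h1.const_mul (1 + 2 * b)).fun_sub (h2.const_mul (2 * b))).const_mul
      ((-(2 * c)) ^ k * (k.factorial : ℝ))).const_mul (2 * c)).congr_deriv ?_
    rw [Nat.factorial_succ]
    push_cast
    ring
  · funext x
    rw [kernelNegLogDeriv, zero_add, pow_one, pow_one, Complex.div_re, normSq_mul_add_mul_I,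
      re_mul_add_mul_I, Complex.ofReal_re, Complex.ofReal_im]
    simp only [Nat.factorial_zero, pow_zero, Nat.cast_one]
    ring

lemma neg_one_pow_mul_iteratedDeriv_kernelNegLogDeriv_nonneg (hb : 0 ≤ b) (hc : 0 ≤ c) (k : ℕ)
    (hx : 0 < 1 + 2 * c * x) :
    0 ≤ (-1) ^ k * iteratedDeriv k (kernelNegLogDeriv b c t) x := by
  rw [iteratedDeriv_kernelNegLogDeriv k hx]
  set w : ℂ := (Real.cos t : ℂ) / (Real.cos t * (1 + 2 * c * x) + Real.sin t * Complex.I)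
  have hw : ‖w‖ ≤ 1 / (1 + 2 * c * x) := by
    have h : |Real.cos t| * (1 + 2 * c * x)
        ≤ ‖(Real.cos t * (1 + 2 * c * x) + Real.sin t * Complex.I : ℂ)‖ := by
      have := Complex.abs_re_le_norm (Real.cos t * (1 + 2 * c * x) + Real.sin t * Complex.I : ℂ)
      rwa [re_mul_add_mul_I, abs_mul, abs_of_pos hx] at this
    rw [norm_div, Complex.norm_real, Real.norm_eq_abs]
    rcases (norm_nonneg
      (Real.cos t * (1 + 2 * c * x) + Real.sin t * Complex.I : ℂ)).eq_or_lt with h0 | h0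
    · rw [← h0, div_zero]; positivity
    · rw [div_le_div_iff₀ h0 hx]; linarith
  have hre : (w ^ (k + 1)).re ≤ (1 / (1 + 2 * c * x)) ^ (k + 1) :=
    (Complex.re_le_norm _).trans (by rw [norm_pow]; gcongr)
  rw [show (-1 : ℝ) ^ k * (2 * c * ((-(2 * c)) ^ k * k.factorial *
      ((1 + 2 * b) * (1 / (1 + 2 * c * x)) ^ (k + 1) - 2 * b * (w ^ (k + 1)).re)))
    = 2 * c * ((2 * c) ^ k * k.factorial * ((1 / (1 + 2 * c * x)) ^ (k + 1) +
      2 * b * ((1 / (1 + 2 * c * x)) ^ (k + 1) - (w ^ (k + 1)).re))) by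
    rw [show -(2 * c) = -1 * (2 * c) by ring, mul_pow]
    have : ((-1 : ℝ)) ^ k * (-1) ^ k = 1 := by rw [← mul_pow]; norm_num
    linear_combination (2 * c * ((2 * c) ^ k * k.factorial *
      ((1 + 2 * b) * (1 / (1 + 2 * c * x)) ^ (k + 1) - 2 * b * (w ^ (k + 1)).re))) * this]
  have := sub_nonneg.2 hre
  positivity

lemma hasDerivAt_kernel (hx : 0 < 1 + 2 * c * x) :
    HasDerivAt (fun y => π⁻¹ * ((1 + 2 * c * y)⁻¹ *
      (Real.cos t ^ 2 + Real.sin t ^ 2 / (1 + 2 * c * y) ^ 2) ^ b))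
      (-(kernelNegLogDeriv b c t x * (π⁻¹ * ((1 + 2 * c * x)⁻¹ *
      (Real.cos t ^ 2 + Real.sin t ^ 2 / (1 + 2 * c * x) ^ 2) ^ b)))) x := by
  have hW := cos_sq_mul_add_sin_sq_pos hx t
  have hW' : Real.cos t ^ 2 + Real.sin t ^ 2 / (1 + 2 * c * x) ^ 2
      = (Real.cos t ^ 2 * (1 + 2 * c * x) ^ 2 + Real.sin t ^ 2) / (1 + 2 * c * x) ^ 2 := by
    field_simp
  have hW0 : 0 < Real.cos t ^ 2 + Real.sin t ^ 2 / (1 + 2 * c * x) ^ 2 := by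
    exact cos_sq_add_sin_sq_div_pos hx t
  have hl : HasDerivAt (fun x : ℝ => 1 + 2 * c * x) (2 * c) x := by
    simpa using ((hasDerivAt_id x).const_mul (2 * c)).const_add 1
  have h1 := ((hasDerivAt_const x (Real.sin t ^ 2)).fun_div (hl.fun_pow 2)
    (by positivity)).const_add (Real.cos t ^ 2)
  refine (((hl.fun_inv hx.ne').fun_mul
    (h1.rpow_const (p := b) (.inl hW0.ne'))).const_mul π⁻¹).congr_deriv ?_
  rw [Real.rpow_sub_one hW0.ne', kernelNegLogDeriv]
  set P := (Real.cos t ^ 2 + Real.sin t ^ 2 / (1 + 2 * c * x) ^ 2) ^ b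
  rw [hW']
  generalize 1 + 2 * c * x = u at hx hW ⊢
  have hW1 : u ^ 2 * Real.cos t ^ 2 + Real.sin t ^ 2 ≠ 0 := by
    rw [mul_comm]; exact hW.ne'
  push_cast
  field_simp
  ring

end LogDerivativeOfKernel

theorem stmt7 (c n : ℝ) (hc : 0 ≤ c) (hn : c < n) :
    (∀ m : ℕ, ∀ x : ℝ, 0 ≤ x → 0 < (-1 : ℝ) ^ m * iteratedDeriv m (Sc c n) x) ∧
    ConvexOn ℝ (Set.Ici 0) (fun x : ℝ => Real.log (Sc c n x)) ∧
    ConvexOn ℝ (Set.Ici 0) (Sc c n) := by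
  have hπ : -(π / 2) < π / 2 := by linarith [Real.pi_pos]
  rcases hc.eq_or_lt with rfl | hc
  · refine completelyMonotone_and_convexOn_of_eqOn_intervalIntegral hπ isOpen_univ
      (convex_Ici 0) (subset_univ _)
      (F := fun x t => π⁻¹ * Real.exp (-(4 * n * Real.sin t ^ 2) * x))
      (G := fun _ t => 4 * n * Real.sin t ^ 2) (by fun_prop) (fun t => contDiffOn_const)
      (fun t x _ => ?_) (fun t x _ => by positivity) (fun t k x _ => ?_)
      ⟨π / 2, ⟨hπ.le, le_rfl⟩, fun x _ => by simpa using hn⟩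
      (fun x _ => Sc_zero_eq_integral)
    · refine ((((hasDerivAt_id x).const_mul
        (-(4 * n * Real.sin t ^ 2))).exp).const_mul π⁻¹).congr_deriv ?_
      simp only [id, mul_one]
      ring
    · rw [iteratedDeriv_const]
      split_ifs with h
      · subst h
        simpa using by positivity
      · simp
  · refine completelyMonotone_and_convexOn_of_eqOn_intervalIntegral hπ
      (U := {x | 0 < 1 + 2 * c * x}) (isOpen_lt (by fun_prop) (by fun_prop)) (convex_Ici 0)
      (fun x hx => ?_)
      (F := fun x t => π⁻¹ * ((1 + 2 * c * x)⁻¹ *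
        (Real.cos t ^ 2 + Real.sin t ^ 2 / (1 + 2 * c * x) ^ 2) ^ (n / c - 1)))
      (G := fun x t => kernelNegLogDeriv (n / c - 1) c t x) ?_
      (fun t => contDiffOn_kernelNegLogDeriv) (fun t x hx => hasDerivAt_kernel hx)
      (fun t x hx => ?_)
      (fun t k x hx =>
        neg_one_pow_mul_iteratedDeriv_kernelNegLogDeriv_nonneg ?_ hc.le k hx)
      ⟨π / 2, ⟨hπ.le, le_rfl⟩, fun x hx => ?_⟩
      (fun x hx => Sc_eq_integral_of_pos hc hx)
    · have : (0 : ℝ) ≤ x := hx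
      show 0 < 1 + 2 * c * x
      positivity
    · have hl : ContDiffOn ℝ ∞ (fun p : ℝ × ℝ => 1 + 2 * c * p.1)
          ({x | 0 < 1 + 2 * c * x} ×ˢ univ) := by fun_prop
      refine contDiffOn_const.mul ((hl.inv fun p hp => ne_of_gt hp.1).mul
        (ContDiffOn.rpow_const_of_ne (.add (by fun_prop) (.div (by fun_prop) (hl.pow 2)
          fun p hp => pow_ne_zero 2 (ne_of_gt hp.1))) fun p hp => ?_))
      exact (cos_sq_add_sin_sq_div_pos hp.1 p.2).ne'
    · have hx' : 0 < 1 + 2 * c * x := hx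
      have := cos_sq_add_sin_sq_div_pos hx' t
      positivity
    · rw [sub_nonneg, one_le_div hc]
      exact hn.le
    · have hx' : 0 < 1 + 2 * c * x := hx
      have hb : 1 < n / c := (one_lt_div hc).2 hn
      simp only [kernelNegLogDeriv, Real.cos_pi_div_two]
      have : 0 < 1 + 2 * (n / c - 1) := by linarith
      simp only [ne_eq, OfNat.ofNat_ne_zero, not_false_eq_true, zero_pow, zero_mul, zero_div,
        mul_zero, sub_zero]
      positivity
end

section
/- Let $c \ge 0$ and $n > c$ be real numbers. Then $u = R'_{n,c}$ (the derivative of the Rényi entropy of order 2) is a solution on $(0,+\infty)$ of the Riccati equation $x(1+cx)(1+2cx)\,u'(x) = x(1+cx)(1+2cx)\,u^2(x) - \left(4(n+c)x(1+cx)+1\right)u(x) + 2n(1+2cx)$. -/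
/-- The Rényi entropy of order 2: `R_{n,c}(x) = -log S_{n,c}(x)`. -/
noncomputable def Rc (c n : ℝ) (x : ℝ) : ℝ := -Real.log (Sc c n x)

open Filter Topology

/-- The coefficients of the termwise derivative of the power series `∑ a k * t ^ k`. -/
def derivCoeff (a : ℕ → ℝ) (k : ℕ) : ℝ := (k + 1) * a (k + 1)

/-- The sum of the power series with coefficients `a`. -/
noncomputable def powerSum (a : ℕ → ℝ) (t : ℝ) : ℝ := ∑' k, a k * t ^ k

lemma summable_derivCoeff {a : ℕ → ℝ} {r ρ : ℝ} (hρ : 0 ≤ ρ) (hr : ρ < r)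
    (h : Summable fun k => |a k| * r ^ k) : Summable fun k => |derivCoeff a k| * ρ ^ k := by
  have hr0 : 0 < r := hρ.trans_lt hr
  have hq : ‖ρ / r‖ < 1 := by
    rw [Real.norm_of_nonneg (by positivity), div_lt_one hr0]; exact hr
  have hb := summable_pow_mul_geometric_of_norm_lt_one 1 hq
  have hb' : Summable fun k : ℕ => ((k : ℝ) + 1) * (ρ / r) ^ k := by
    have := hb.add (summable_geometric_of_norm_lt_one hq)
    refine this.congr fun k => ?_
    ring
  obtain ⟨M, hM⟩ := h.tendsto_atTop_zero.bddAbove_range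
  have hM' : ∀ k, |a k| * r ^ k ≤ M := fun k => hM ⟨k, rfl⟩
  refine Summable.of_nonneg_of_le (fun k => by positivity) (fun k => ?_) (hb'.mul_left (M / r))
  have e : |derivCoeff a k| * ρ ^ k
      = (|a (k + 1)| * r ^ (k + 1)) * (((k : ℝ) + 1) * (ρ / r) ^ k / r) := by
    rw [derivCoeff, abs_mul, abs_of_nonneg (by positivity : (0 : ℝ) ≤ k + 1), div_pow,
      pow_succ r k]
    field_simp
  rw [e]
  calc _ ≤ M * (((k : ℝ) + 1) * (ρ / r) ^ k / r) := by gcongr; exact hM' _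
    _ = _ := by ring

lemma summable_of_abs_le {a : ℕ → ℝ} {r t : ℝ} (ht : |t| ≤ r)
    (h : Summable fun k => |a k| * r ^ k) : Summable fun k => a k * t ^ k := by
  refine Summable.of_norm_bounded h fun k => ?_
  rw [norm_mul, norm_pow, Real.norm_eq_abs, Real.norm_eq_abs]
  gcongr

lemma hasDerivAt_powerSum {a : ℕ → ℝ} {r t : ℝ} (ht : |t| < r)
    (h : Summable fun k => |a k| * r ^ k) :
    HasDerivAt (powerSum a) (powerSum (derivCoeff a) t) t := by
  obtain ⟨ρ, h1, h2⟩ := exists_between ht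
  have hρ : 0 < ρ := (abs_nonneg t).trans_lt h1
  have hD := summable_derivCoeff hρ.le h2 h
  have hu : Summable fun k : ℕ => |a k * (k * ρ ^ (k - 1))| := by
    rw [← summable_nat_add_iff 1]
    refine hD.congr fun k => ?_
    simp only [derivCoeff, abs_mul, abs_pow, abs_of_pos hρ, Nat.add_sub_cancel]
    push_cast
    ring
  have hs := summable_of_abs_le ht.le h
  have key := hasDerivAt_tsum_of_isPreconnected (t := Set.Ioo (-ρ) ρ)
    (g := fun k y => a k * y ^ k) (g' := fun k y => a k * (k * y ^ (k - 1))) hu isOpen_Ioo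
    isPreconnected_Ioo (fun k y _ => (hasDerivAt_pow k y).const_mul (a k))
    (fun k y hy => by
      simp only [norm_mul, norm_pow, Real.norm_eq_abs, abs_mul, abs_pow, abs_of_pos hρ]
      gcongr
      exact (abs_lt.2 ⟨hy.1, hy.2⟩).le) (abs_lt.1 h1) hs (abs_lt.1 h1)
  have e : ∑' k : ℕ, a k * (k * t ^ (k - 1)) = powerSum (derivCoeff a) t := by
    have hs' : Summable fun k : ℕ => a k * (k * t ^ (k - 1)) := by
      rw [← summable_nat_add_iff 1]
      refine (summable_of_abs_le h1.le hD).congr fun k => ?_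
      simp only [derivCoeff, Nat.add_sub_cancel]
      push_cast
      ring
    rw [hs'.tsum_eq_zero_add, powerSum]
    simp only [derivCoeff, Nat.add_sub_cancel, Nat.cast_zero, zero_mul, mul_zero, zero_add]
    refine tsum_congr fun k => ?_
    push_cast
    ring
  rw [← e]
  exact key

lemma hasSum_mul_derivCoeff {a : ℕ → ℝ} {t s : ℝ}
    (h : HasSum (fun k => derivCoeff a k * t ^ k) s) :
    HasSum (fun k : ℕ => k * a k * t ^ k) (t * s) := by
  rw [← hasSum_nat_add_iff' 1]
  simp only [Finset.range_one, Finset.sum_singleton, Nat.cast_zero, zero_mul, sub_zero]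
  convert h.mul_left t using 2 with k
  · rfl
  simp only [derivCoeff]
  push_cast
  ring

/-- A power series whose coefficients satisfy a hypergeometric-type recurrence solves the
corresponding second order equation. -/
lemma powerSum_ode {a : ℕ → ℝ} {n c r t : ℝ} (ht : |t| < r)
    (h : Summable fun k => |a k| * r ^ k)
    (ha : ∀ k : ℕ, ((k : ℝ) + 1) ^ 2 * a (k + 1) = (n + c * k) ^ 2 * a k) :
    t * powerSum (derivCoeff (derivCoeff a)) t + powerSum (derivCoeff a) t
      = n ^ 2 * powerSum a t + (2 * n * c + c ^ 2) * (t * powerSum (derivCoeff a) t)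
        + c ^ 2 * (t * (t * powerSum (derivCoeff (derivCoeff a)) t)) := by
  obtain ⟨ρ, h1, h2⟩ := exists_between ht
  obtain ⟨σ, h3, h4⟩ := exists_between h1
  have hρ := (abs_nonneg t).trans h1.le
  have hσ := (abs_nonneg t).trans h3.le
  have hD := summable_derivCoeff hρ h2 h
  have hDD := summable_derivCoeff hσ h4 hD
  have s0 : HasSum (fun k => a k * t ^ k) (powerSum a t) := (summable_of_abs_le ht.le h).hasSum
  have s1 : HasSum (fun k => derivCoeff a k * t ^ k) (powerSum (derivCoeff a) t) :=
    (summable_of_abs_le h1.le hD).hasSum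
  have s2 : HasSum (fun k => derivCoeff (derivCoeff a) k * t ^ k)
      (powerSum (derivCoeff (derivCoeff a)) t) := (summable_of_abs_le h3.le hDD).hasSum
  have t1 := hasSum_mul_derivCoeff s1
  have t2 := hasSum_mul_derivCoeff s2
  have t3 : HasSum (fun k : ℕ => k * (((k : ℝ) - 1) * a k) * t ^ k)
      (t * (t * powerSum (derivCoeff (derivCoeff a)) t)) := by
    refine hasSum_mul_derivCoeff (a := fun k : ℕ => ((k : ℝ) - 1) * a k) ?_
    convert t2 using 2 with k
    simp only [derivCoeff]
    push_cast
    ring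
  refine (t2.add s1).unique ?_
  convert ((s0.mul_left (n ^ 2)).add (t1.mul_left (2 * n * c + c ^ 2))).add
    (t3.mul_left (c ^ 2)) using 2 with k
  · rfl
  simp only [derivCoeff]
  linear_combination t ^ k * ha k

/-- The squares of the coefficients `n (n + c) ⋯ (n + (k - 1) c) / k!`. -/
noncomputable def sqCoeff (c n : ℝ) (k : ℕ) : ℝ :=
  ((∏ i ∈ Finset.range k, (n + c * i)) / (Nat.factorial k)) ^ 2

lemma sqCoeff_succ (c n : ℝ) (k : ℕ) :
    ((k : ℝ) + 1) ^ 2 * sqCoeff c n (k + 1) = (n + c * k) ^ 2 * sqCoeff c n k := by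
  rw [sqCoeff, sqCoeff, Finset.prod_range_succ, Nat.factorial_succ]
  push_cast
  have : (Nat.factorial k : ℝ) ≠ 0 := by positivity
  field_simp

lemma sqCoeff_pos {c n : ℝ} (hc : 0 ≤ c) (hn : 0 < n) (k : ℕ) : 0 < sqCoeff c n k := by
  have : 0 < ∏ i ∈ Finset.range k, (n + c * i) := Finset.prod_pos fun i _ => by positivity
  rw [sqCoeff]
  positivity

lemma summable_sqCoeff {c n r : ℝ} (hc : 0 ≤ c) (hn : 0 < n) (hr : 0 < r) (hcr : c ^ 2 * r < 1) :
    Summable fun k => |sqCoeff c n k| * r ^ k := by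
  have hpos := sqCoeff_pos hc hn
  refine summable_of_ratio_test_tendsto_lt_one hcr
    (Eventually.of_forall fun k => ?_) ?_
  · have := hpos k
    positivity
  · have h1 : Tendsto (fun k : ℕ => (c + (n - c) * (1 / ((k : ℝ) + 1))) ^ 2 * r) atTop
        (𝓝 ((c + (n - c) * 0) ^ 2 * r)) :=
      (((tendsto_one_div_add_atTop_nhds_zero_nat.const_mul _).const_add _).pow 2).mul_const _
    rw [mul_zero, add_zero] at h1
    refine h1.congr fun k => ?_
    have hk := hpos k
    have hk' := hpos (k + 1)
    have e : sqCoeff c n (k + 1) = (n + c * k) ^ 2 * sqCoeff c n k / ((k : ℝ) + 1) ^ 2 := by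
      rw [← sqCoeff_succ]
      field_simp
    rw [abs_of_pos hk, abs_of_pos hk', Real.norm_of_nonneg (by positivity),
      Real.norm_of_nonneg (by positivity), e]
    field_simp
    ring

/-- The probability `p_{n,0}^{[c]}`. -/
noncomputable def pcZero (c n x : ℝ) : ℝ :=
  if c = 0 then Real.exp (-(n * x)) else (1 + c * x) ^ (-n / c)

lemma pcZero_pos {c n x : ℝ} (hc : 0 ≤ c) (hx : 0 < x) : 0 < pcZero c n x := by
  unfold pcZero
  split_ifs <;> positivity

lemma hasDerivAt_pcZero {c n x : ℝ} (hc : 0 ≤ c) (hx : 0 < x) :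
    HasDerivAt (pcZero c n) (-n / (1 + c * x) * pcZero c n x) x := by
  have hl (a : ℝ) : HasDerivAt (fun y => a * y) a x := by
    simpa using (hasDerivAt_id x).const_mul a
  by_cases h : c = 0
  · subst h
    have e : pcZero 0 n = fun y => Real.exp (-(n * y)) := by
      funext y
      simp [pcZero]
    rw [e]
    refine (hl n).neg.exp.congr_deriv ?_
    simp only [Pi.neg_apply]
    ring
  · have hp : 0 < 1 + c * x := by positivity
    have e : pcZero c n = fun y => (1 + c * y) ^ (-n / c) := by
      funext y
      simp [pcZero, h]
    rw [e]
    convert ((hl c).const_add 1).rpow_const (p := -n / c) (Or.inl hp.ne') using 1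
    rw [Real.rpow_sub_one hp.ne']
    field_simp

lemma pc_eq {c n x : ℝ} (hc : 0 ≤ c) (hx : 0 < x) (k : ℕ) :
    pc c n k x = (∏ i ∈ Finset.range k, (n + c * i)) / (Nat.factorial k)
      * (x / (1 + c * x)) ^ k * pcZero c n x := by
  by_cases h : c = 0
  · subst h
    simp [pc, pcZero, mul_pow]
    ring
  · have hp : 0 < 1 + c * x := by positivity
    have e : (∏ i ∈ Finset.range k, (n + c * i))
        = (-1) ^ k * c ^ k * ∏ i ∈ Finset.range k, (-n / c - i) := by
      rw [← mul_pow, ← Finset.card_range k, ← Finset.prod_const, Finset.card_range,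
        ← Finset.prod_mul_distrib]
      refine Finset.prod_congr rfl fun i _ => ?_
      field_simp
      ring
    rw [pc, if_neg h, pcZero, if_neg h, genBinom, e, Real.rpow_sub_natCast hp.ne', mul_pow, div_pow]
    field_simp

lemma Sc_eq {c n x : ℝ} (hc : 0 ≤ c) (hx : 0 < x) :
    Sc c n x = pcZero c n x ^ 2 * powerSum (sqCoeff c n) ((x / (1 + c * x)) ^ 2) := by
  rw [Sc, powerSum, ← tsum_mul_left]
  refine tsum_congr fun k => ?_
  rw [pc_eq hc hx, sqCoeff]
  ring

lemma exists_summable_radius {c n x : ℝ} (hc : 0 ≤ c) (hn : 0 < n) (hx : 0 < x) :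
    ∃ r, |(x / (1 + c * x)) ^ 2| < r ∧ Summable fun k => |sqCoeff c n k| * r ^ k := by
  refine ⟨((x + 1) / (1 + c * (x + 1))) ^ 2, ?_, summable_sqCoeff hc hn (by positivity) ?_⟩
  · rw [abs_of_nonneg (by positivity)]
    have : x / (1 + c * x) < (x + 1) / (1 + c * (x + 1)) := by
      rw [div_lt_div_iff₀ (by positivity) (by positivity)]
      linarith
    gcongr
  · rw [← mul_pow, ← mul_div_assoc]
    have h0 : 0 ≤ c * (x + 1) / (1 + c * (x + 1)) := by positivity
    have : c * (x + 1) / (1 + c * (x + 1)) < 1 := by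
      rw [div_lt_one (by positivity)]
      linarith
    exact pow_lt_one₀ h0 this two_ne_zero

lemma Sc_pos {c n x : ℝ} (hc : 0 ≤ c) (hn : 0 < n) (hx : 0 < x) : 0 < Sc c n x := by
  obtain ⟨r, hr, hs⟩ := exists_summable_radius hc hn hx
  rw [Sc_eq hc hx]
  have h0 := pcZero_pos (n := n) hc hx
  have h1 : 0 < powerSum (sqCoeff c n) ((x / (1 + c * x)) ^ 2) :=
    (summable_of_abs_le hr.le hs).tsum_pos
      (fun k => mul_nonneg (sqCoeff_pos hc hn k).le (by positivity)) 0
      (by simpa using sqCoeff_pos hc hn 0)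
  positivity

/-- The derivative of `Sc c n` on the positive half-line. -/
noncomputable def ScDeriv (c n x : ℝ) : ℝ :=
  pcZero c n x ^ 2 * (-2 * n / (1 + c * x) * powerSum (sqCoeff c n) ((x / (1 + c * x)) ^ 2)
    + 2 * x / (1 + c * x) ^ 3 * powerSum (derivCoeff (sqCoeff c n)) ((x / (1 + c * x)) ^ 2))

lemma hasDerivAt_one_add_mul (c x : ℝ) : HasDerivAt (fun y => 1 + c * y) c x := by
  simpa using ((hasDerivAt_id x).const_mul c).const_add 1

lemma hasDerivAt_div_sq {c x : ℝ} (hc : 0 ≤ c) (hx : 0 < x) :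
    HasDerivAt (fun y => (y / (1 + c * y)) ^ 2) (2 * x / (1 + c * x) ^ 3) x := by
  have hp : 1 + c * x ≠ 0 := by positivity
  refine (((hasDerivAt_id x).div (hasDerivAt_one_add_mul c x) hp).pow 2).congr_deriv ?_
  simp only [Pi.div_apply, id_eq]
  push_cast
  field_simp
  ring

lemma hasDerivAt_Sc {c n x : ℝ} (hc : 0 ≤ c) (hn : 0 < n) (hx : 0 < x) :
    HasDerivAt (Sc c n) (ScDeriv c n x) x := by
  obtain ⟨r, hr, hs⟩ := exists_summable_radius hc hn hx
  have h := ((hasDerivAt_pcZero (n := n) hc hx).pow 2).mul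
    (HasDerivAt.comp x (hasDerivAt_powerSum hr hs) (hasDerivAt_div_sq hc hx))
  refine (h.congr_of_eventuallyEq ?_).congr_deriv ?_
  · filter_upwards [Ioi_mem_nhds hx] with y hy
    exact Sc_eq hc hy
  · simp only [ScDeriv, Function.comp_apply, Pi.pow_apply]
    push_cast
    ring

lemma exists_hasDerivAt_ScDeriv {c n x : ℝ} (hc : 0 ≤ c) (hn : 0 < n) (hx : 0 < x) :
    ∃ s, HasDerivAt (ScDeriv c n) s x ∧
      x * (1 + c * x) * (1 + 2 * c * x) * s
        + (4 * (n + c) * x * (1 + c * x) + 1) * ScDeriv c n x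
        + 2 * n * (1 + 2 * c * x) * Sc c n x = 0 := by
  obtain ⟨r, hr, hs⟩ := exists_summable_radius hc hn hx
  obtain ⟨ρ, h1, h2⟩ := exists_between hr
  have hD := summable_derivCoeff ((abs_nonneg _).trans h1.le) h2 hs
  have hp : 1 + c * x ≠ 0 := by positivity
  have ht := hasDerivAt_div_sq hc hx
  have hl := hasDerivAt_one_add_mul c x
  have hx2 : HasDerivAt (fun y : ℝ => 2 * y) 2 x := by
    simpa using (hasDerivAt_id x).const_mul 2
  have h := ((hasDerivAt_pcZero (n := n) hc hx).pow 2).mul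
    ((((hasDerivAt_const x (-2 * n)).div hl hp).mul
      (HasDerivAt.comp x (hasDerivAt_powerSum hr hs) ht)).add
    ((hx2.div (hl.pow 3) (pow_ne_zero 3 hp)).mul
      (HasDerivAt.comp x (hasDerivAt_powerSum h1 hD) ht)))
  refine ⟨_, h, ?_⟩
  have ode := sub_eq_zero.2 (powerSum_ode hr hs (sqCoeff_succ c n))
  rw [Sc_eq hc hx, ScDeriv]
  refine Eq.trans ?_ (mul_eq_zero_of_right (pcZero c n x ^ 2 * (4 * x / (1 + c * x))) ode)
  simp only [Function.comp_apply, Pi.pow_apply, Pi.mul_apply, Pi.add_apply, Pi.div_apply]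
  generalize powerSum (derivCoeff (derivCoeff (sqCoeff c n))) ((x / (1 + c * x)) ^ 2) = F2
  generalize powerSum (derivCoeff (sqCoeff c n)) ((x / (1 + c * x)) ^ 2) = F1
  generalize powerSum (sqCoeff c n) ((x / (1 + c * x)) ^ 2) = F0
  generalize pcZero c n x = E
  push_cast
  field_simp
  ring

theorem stmt11 (c n : ℝ) (hc : 0 ≤ c) (hn : c < n) :
    ∀ x ∈ Set.Ioi (0 : ℝ),
      x * (1 + c * x) * (1 + 2 * c * x) * deriv (deriv (Rc c n)) x
        = x * (1 + c * x) * (1 + 2 * c * x) * (deriv (Rc c n) x) ^ 2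
          - (4 * (n + c) * x * (1 + c * x) + 1) * deriv (Rc c n) x
          + 2 * n * (1 + 2 * c * x) := by
  intro x hx
  have hx : 0 < x := hx
  have hn0 : 0 < n := hc.trans_lt hn
  have hR {y : ℝ} (hy : 0 < y) : deriv (Rc c n) y = -(ScDeriv c n y / Sc c n y) :=
    ((hasDerivAt_Sc hc hn0 hy).log (Sc_pos hc hn0 hy).ne').neg.deriv
  have hS := Sc_pos hc hn0 hx
  obtain ⟨s, hs, ode⟩ := exists_hasDerivAt_ScDeriv hc hn0 hx
  have hev : deriv (Rc c n) =ᶠ[𝓝 x] -(ScDeriv c n / Sc c n) := by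
    filter_upwards [Ioi_mem_nhds hx] with y hy
    exact hR hy
  rw [hev.deriv_eq, ((hs.div (hasDerivAt_Sc hc hn0 hx) hS.ne').neg).deriv, hR hx]
  field_simp
  linear_combination (-(Sc c n x)) * ode
end
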